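/- For every nonzero ψ ∈ ℝ³ with θ = ‖ψ‖, det A(ψ) = 2(1 − cos θ)/θ². In particular, for 0 < θ < 2π one has 0 < det A(ψ) < 1, so det A(ψ)⁻¹ ≠ 1 and the map p ↦ A(ψ)⁻¹ p does not preserve Euclidean length; hence the Lie-algebra-based error function on SE(3) is not the squared geodesic distance (1/2)‖ψ‖² + (1/2)‖p − p_d‖². -/

import Mathlib

open Matrix

noncomputable section

/-- Hat map: `hat x` is the 3×3 skew-symmetric matrix with `(hat x) *ᵥ y = x ×₃ y`. -/
def hat (x : Fin 3 → ℝ) : Matrix (Fin 3) (Fin 3) ℝ :=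
  !![0, -x 2, x 1; x 2, 0, -x 0; -x 1, x 0, 0]

/-- Vee map: the inverse of the hat map on skew-symmetric matrices. -/
def vee (S : Matrix (Fin 3) (Fin 3) ℝ) : Fin 3 → ℝ :=
  ![S 2 1, S 0 2, S 1 0]

/-- Euclidean norm on ℝ³. -/
def enorm3 (x : Fin 3 → ℝ) : ℝ := Real.sqrt (x ⬝ᵥ x)

/-- `R ∈ SO(3)`: `RᵀR = I` and `det R = 1`. -/
def SO3 (R : Matrix (Fin 3) (Fin 3) ℝ) : Prop := Rᵀ * R = 1 ∧ R.det = 1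

/-- Squared Frobenius norm: `‖A‖_F² = tr(AᵀA)`. -/
def frobSq {n : Type*} [Fintype n] (A : Matrix n n ℝ) : ℝ := (Aᵀ * A).trace

/-- The 4×4 homogeneous matrix `[[R, p],[0, 1]]` of `(R, p) ∈ SE(3)`. -/
def homog (R : Matrix (Fin 3) (Fin 3) ℝ) (p : Fin 3 → ℝ) :
    Matrix (Fin 3 ⊕ Fin 1) (Fin 3 ⊕ Fin 1) ℝ :=
  Matrix.fromBlocks R (Matrix.of fun i _ => p i) 0 1

/-- se(3) element `ξ̂ = [[ω̂, v],[0, 0]]` for `ξ = (v, ω)`. -/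
def xihat (v ω : Fin 3 → ℝ) : Matrix (Fin 3 ⊕ Fin 1) (Fin 3 ⊕ Fin 1) ℝ :=
  Matrix.fromBlocks (hat ω) (Matrix.of fun i _ => v i) 0 0

/-- The matrix `A(ψ) = I + ((1-cos θ)/θ)(ψ̂/θ) + (1 - sin θ/θ)(ψ̂²/θ²)`, `θ = ‖ψ‖`. -/
def Amat (ψ : Fin 3 → ℝ) : Matrix (Fin 3) (Fin 3) ℝ :=
  1 + ((1 - Real.cos (enorm3 ψ)) / (enorm3 ψ) ^ 2) • hat ψ
    + ((1 - Real.sin (enorm3 ψ) / enorm3 ψ) / (enorm3 ψ) ^ 2) • (hat ψ) ^ 2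

/-- The 6×6 Adjoint matrix `Ad_g = [[R, p̂R],[0, R]]`, acting on `ξ = (v, ω)`. -/
def Ad6 (R : Matrix (Fin 3) (Fin 3) ℝ) (p : Fin 3 → ℝ) :
    Matrix (Fin 3 ⊕ Fin 3) (Fin 3 ⊕ Fin 3) ℝ :=
  Matrix.fromBlocks R (hat p * R) 0 R

lemma enorm3_sq (x : Fin 3 → ℝ) : enorm3 x ^ 2 = x 0 ^ 2 + x 1 ^ 2 + x 2 ^ 2 := by
  have h : x ⬝ᵥ x = x 0 ^ 2 + x 1 ^ 2 + x 2 ^ 2 := by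
    simp [dotProduct, Fin.sum_univ_three]; ring
  rw [enorm3, h, Real.sq_sqrt (by positivity)]

lemma enorm3_pos {x : Fin 3 → ℝ} (hx : x ≠ 0) : 0 < enorm3 x :=
  Real.sqrt_pos.mpr (lt_of_le_of_ne
    (Finset.sum_nonneg fun i _ => mul_self_nonneg (x i))
    (fun h => hx (dotProduct_self_eq_zero.mp h.symm)))

lemma det_one_add_hat (x : Fin 3 → ℝ) (a b : ℝ) :
    (1 + a • hat x + b • hat x ^ 2).det =
      (1 - b * enorm3 x ^ 2) ^ 2 + a ^ 2 * enorm3 x ^ 2 := by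
  rw [enorm3_sq]
  simp [det_fin_three, hat, pow_two, one_apply]
  ring

lemma frobSq_one_add_hat (x : Fin 3 → ℝ) (a b : ℝ) :
    frobSq (1 + a • hat x + b • hat x ^ 2) =
      1 + 2 * (1 + a • hat x + b • hat x ^ 2).det := by
  rw [det_one_add_hat, enorm3_sq]
  simp [frobSq, trace, hat, pow_two, one_apply, Matrix.mul_apply, Fin.sum_univ_three]
  ring

lemma frobSq_eq_three_of_enorm3_mulVec {A : Matrix (Fin 3) (Fin 3) ℝ}
    (h : ∀ p, enorm3 (A *ᵥ p) = enorm3 p) : frobSq A = 3 := by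
  have hcol (i : Fin 3) : A 0 i ^ 2 + A 1 i ^ 2 + A 2 i ^ 2 = 1 := by
    have hi := congrArg (· ^ 2) (h (Pi.single i 1))
    simp only [enorm3_sq, mulVec_single_one, col_apply] at hi
    rw [hi]
    fin_cases i <;> simp
  have h0 := hcol 0
  have h1 := hcol 1
  have h2 := hcol 2
  simp only [frobSq, trace, diag_apply, Matrix.mul_apply, transpose_apply, Fin.sum_univ_three]
  linarith

/-- for nonzero `ψ` with `θ = ‖ψ‖`, `det A(ψ) = 2(1 − cos θ)/θ²`; for
`θ < 2π`, `0 < det A(ψ) < 1`, so `det A(ψ)⁻¹ ≠ 1` and `p ↦ A(ψ)⁻¹p` does not preserve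
Euclidean length. -/
theorem det_Amat (ψ : Fin 3 → ℝ) (hψ : ψ ≠ 0) :
    (Amat ψ).det = 2 * (1 - Real.cos (enorm3 ψ)) / (enorm3 ψ) ^ 2 ∧
    (enorm3 ψ < 2 * Real.pi →
      0 < (Amat ψ).det ∧ (Amat ψ).det < 1 ∧ ((Amat ψ)⁻¹).det ≠ 1 ∧
      ∃ p : Fin 3 → ℝ, enorm3 ((Amat ψ)⁻¹ *ᵥ p) ≠ enorm3 p) := by
  have hθ := enorm3_pos hψ
  have hdet : (Amat ψ).det = 2 * (1 - Real.cos (enorm3 ψ)) / (enorm3 ψ) ^ 2 := by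
    rw [Amat, det_one_add_hat]
    field_simp
    linear_combination Real.sin_sq_add_cos_sq (enorm3 ψ)
  refine ⟨hdet, fun hlt => ?_⟩
  have hcos : Real.cos (enorm3 ψ) < 1 :=
    lt_of_le_of_ne (Real.cos_le_one _) fun h =>
      hθ.ne' ((Real.cos_eq_one_iff_of_lt_of_lt (by linarith) hlt).mp h)
  have hpos : 0 < (Amat ψ).det := by
    rw [hdet]
    exact div_pos (by linarith) (by positivity)
  have hlt_one : (Amat ψ).det < 1 := by
    rw [hdet, div_lt_one (by positivity)]
    linarith [Real.one_sub_sq_div_two_lt_cos hθ.ne']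
  refine ⟨hpos, hlt_one, ?_, ?_⟩
  · rw [det_nonsing_inv, Ring.inverse_eq_inv', Ne, inv_eq_one]
    exact hlt_one.ne
  · by_contra! h
    have hfrob : frobSq (Amat ψ) = 3 := frobSq_eq_three_of_enorm3_mulVec fun p => by
      rw [← h (Amat ψ *ᵥ p), mulVec_mulVec, nonsing_inv_mul _ hpos.ne'.isUnit, one_mulVec]
    have hfrob_det : frobSq (Amat ψ) = 1 + 2 * (Amat ψ).det := frobSq_one_add_hat ψ _ _
    linarith
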